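/- Let u ∈ V satisfy u_n u = 0 for all n ≥ 0, let ℓ be a positive integer, and let (W, Y_W^φ) be a (G,χ)-equivariant φ-coordinated quasi V-module. Then there exists a polynomial q(z) ∈ ℂ[z] all of whose roots lie in χ(G)∖{1} such that (∏_{1≤i<j≤ℓ+1} q(z_i/z_j)) Y_W^φ(u,z₁)⋯Y_W^φ(u,z_{ℓ+1}) ∈ Hom(W, W((z₁,…,z_{ℓ+1}))). Moreover, if (u_{-1})^{ℓ+1}𝟏 = 0 in V, then (∏_{1≤i<j≤ℓ+1} q(z_i/z_j)) Y_W^φ(u,z₁)⋯Y_W^φ(u,z_{ℓ+1}) |_{z₁=⋯=z_{ℓ+1}} = 0; conversely, if W is faithful and this evaluation vanishes, then (u_{-1})^{ℓ+1}𝟏 = 0 in V. -/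

import Mathlib

noncomputable section
open scoped BigOperators

/-- The generalized binomial coefficient `binom(m, i) = m(m-1)⋯(m-i+1)/i!` as a complex
number, for `m : ℤ`. -/
def intChoose (m : ℤ) (i : ℕ) : ℂ :=
  (∏ j ∈ Finset.range i, ((m : ℂ) - (j : ℂ))) / (Nat.factorial i : ℂ)

/-- A vertex algebra over `ℂ`, presented through its modes: `Y v n` is the operator `v_n`,
so that `Y(v,z) = ∑_{n ∈ ℤ} v_n z^{-n-1}`. -/
structure VertexAlg (V : Type) [AddCommGroup V] [Module ℂ V] where
  /-- the modes `v ↦ vₙ` of the vertex operator `Y(v,z) = ∑ₙ vₙ z^{-n-1}` -/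
  Y : V → ℤ → Module.End ℂ V
  /-- the vacuum vector -/
  one : V
  Y_add : ∀ u v n, Y (u + v) n = Y u n + Y v n
  Y_smul : ∀ (c : ℂ) u n, Y (c • u) n = c • Y u n
  /-- lower truncation: `uₙ v = 0` for `n` sufficiently large -/
  trunc : ∀ u v, ∃ N : ℤ, ∀ n, N ≤ n → Y u n v = 0
  /-- `Y(𝟏, z) = id` -/
  vacuum_Y : ∀ n, Y one n = if n = -1 then 1 else 0
  /-- creation: `Y(v,z)𝟏 ∈ V[[z]]` -/
  create : ∀ v n, 0 ≤ n → Y v n one = 0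
  /-- creation: `Y(v,z)𝟏|_{z=0} = v` -/
  create_neg_one : ∀ v, Y v (-1) one = v
  /-- the Borcherds (Jacobi) identity in coefficient form -/
  borcherds : ∀ u v w : V, ∀ m n k : ℤ,
    (∑ᶠ i : ℕ, intChoose m i • Y (Y u (n + i) v) (m + k - i) w) =
      ∑ᶠ i : ℕ, ((-1 : ℂ) ^ i * intChoose n i) •
        (Y u (m + n - i) (Y v (k + i) w)
          - ((-1 : ℂ) ^ n) • Y v (n + k - i) (Y u (m + i) w))

namespace VertexAlg

variable {V : Type} [AddCommGroup V] [Module ℂ V]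

/-- the canonical derivation `𝒟 v = v₋₂𝟏` of a vertex algebra -/
def D (VA : VertexAlg V) (v : V) : V := VA.Y v (-2) VA.one

/-- a linear automorphism of `V` is an automorphism of the vertex algebra `VA` if it fixes the
vacuum and intertwines all modes. -/
def IsAuto (VA : VertexAlg V) (g : V ≃ₗ[ℂ] V) : Prop :=
  g VA.one = VA.one ∧ ∀ u n v, g (VA.Y u n v) = VA.Y (g u) n (g v)

/-- an ideal of a vertex algebra: a subspace stable under left and right modes. -/
def IsIdeal (VA : VertexAlg V) (I : Submodule ℂ V) : Prop :=
  ∀ u ∈ I, ∀ (v : V) (n : ℤ), VA.Y u n v ∈ I ∧ VA.Y v n u ∈ I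

/-- a vertex algebra is simple if its only ideals are `⊥` and `⊤`. -/
def IsSimpleVA (VA : VertexAlg V) : Prop :=
  ∀ I : Submodule ℂ V, IsIdeal VA I → I = ⊥ ∨ I = ⊤

end VertexAlg

/-- Coefficient of `z₁^m z₂^k` in `f(z₁/z₂) A(z₁) B(z₂)`, where `A(z) = ∑ₙ (A n) zⁿ`,
`B(z) = ∑ₙ (B n) zⁿ` are fields written with `n`-th coefficient convention. -/
def pCoeff2 {W : Type} [AddCommGroup W] [Module ℂ W]
    (A B : ℤ → Module.End ℂ W) (f : Polynomial ℂ) (m k : ℤ) :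
    Module.End ℂ W :=
  ∑ i ∈ f.support, f.coeff i • (A (m - i) * B (k + i))

/-- coefficient of `z^s` in `e^{i z}` -/
def expC (i : ℕ) (s : ℤ) : ℂ :=
  if 0 ≤ s then (i : ℂ) ^ s.toNat / (Nat.factorial s.toNat : ℂ) else 0

/-- coefficient of `z₀^r` in `e^{m z₀}` (the substitution `z₁ = z₂ e^{z₀}` applied to `z₁^m`
produces `z₂^m e^{m z₀}`). -/
def subC (m : ℤ) (r : ℤ) : ℂ :=
  if 0 ≤ r then (m : ℂ) ^ r.toNat / (Nat.factorial r.toNat : ℂ) else 0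

/-- A `(G,χ)`-equivariant `φ`-coordinated quasi module for a vertex algebra `VA`, where
`φ(z₂,z₀) = z₂ e^{z₀}`.  The field `Y_W^φ(v,z)` is recorded through its coefficients:
`Y_W^φ(v,z) = ∑_{n ∈ ℤ} (E v n) zⁿ`. -/
structure PhiMod {V : Type} [AddCommGroup V] [Module ℂ V] (VA : VertexAlg V)
    {G : Type} [Group G] (ρ : G →* (V ≃ₗ[ℂ] V)) (χ : G →* ℂˣ)
    (W : Type) [AddCommGroup W] [Module ℂ W] where
  /-- `E v n` is the coefficient of `zⁿ` in `Y_W^φ(v, z)` -/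
  E : V → ℤ → Module.End ℂ W
  E_add : ∀ u v n, E (u + v) n = E u n + E v n
  E_smul : ∀ (c : ℂ) v n, E (c • v) n = c • E v n
  /-- `Y_W^φ(v,z) ∈ Hom(W, W((z)))` -/
  lower_trunc : ∀ v w, ∃ N : ℤ, ∀ n, n < N → E v n w = 0
  /-- `Y_W^φ(𝟏,z) = 1_W` -/
  vacuum : ∀ n, E VA.one n = if n = 0 then 1 else 0
  /-- `Y_W^φ(gv, z) = Y_W^φ(v, χ(g)z)` -/
  equivar : ∀ (g : G) (v : V) (n : ℤ), E (ρ g v) n = (((χ g : ℂ)) ^ n) • E v n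
  /-- for all `u,v` there is `f ∈ ℂ_{χ(G)}[z]` such that
  `f(z₁/z₂) Y^φ(u,z₁) Y^φ(v,z₂) ∈ Hom(W, W((z₁,z₂)))` and
  `f(e^{z₀}) Y^φ(Y(u,z₀)v, z₂) = (f(z₁/z₂)Y^φ(u,z₁)Y^φ(v,z₂))|_{z₁ = z₂e^{z₀}}`,
  both written out in coefficients (of `z₁^m z₂^k`, resp. of `z₀^r z₂^n`). -/
  assoc : ∀ u v : V, ∃ f : Polynomial ℂ, f ≠ 0 ∧
    (∀ c : ℂ, f.IsRoot c → ∃ g : G, ((χ g : ℂ)) = c) ∧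
    (∀ w : W, ∃ N : ℤ, ∀ m k : ℤ, (m < N ∨ k < N) →
      pCoeff2 (E u) (E v) f m k w = 0) ∧
    (∀ (r n : ℤ) (w : W),
      (∑ᶠ j : ℤ, (∑ i ∈ f.support, f.coeff i * expC i (r + j + 1)) • E (VA.Y u j v) n w)
        = ∑ᶠ m : ℤ, subC m r • pCoeff2 (E u) (E v) f m (n - m) w)

/-- a `(G,χ)`-equivariant `φ`-coordinated quasi module `(W, Y_W^φ, d)`: additionally an
endomorphism `d` with `[d, Y_W^φ(v,z)] = Y_W^φ(𝒟v, z)`. -/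
structure PhiModD {V : Type} [AddCommGroup V] [Module ℂ V] (VA : VertexAlg V)
    {G : Type} [Group G] (ρ : G →* (V ≃ₗ[ℂ] V)) (χ : G →* ℂˣ)
    (W : Type) [AddCommGroup W] [Module ℂ W] extends PhiMod VA ρ χ W where
  d : Module.End ℂ W
  d_comm : ∀ (v : V) (n : ℤ), d * E v n - E v n * d = E (VA.D v) n

end

noncomputable section

/-- The net shift of the exponent of the variable `z_i` coming from choosing the monomial
`(z_i/z_j)^{a i j}` in each factor `q(z_i/z_j)`, `i < j`. -/
def shiftIdx {L : ℕ} (a : Fin L → Fin L → ℕ) (i : Fin L) : ℤ :=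
  (∑ j : Fin L, if i < j then (a i j : ℤ) else 0)
    - (∑ j : Fin L, if j < i then (a j i : ℤ) else 0)

/-- the product of the chosen coefficients `∏_{i<j} q_{a i j}` (zero off the support of the
exponent choice). -/
def pairWeight {L : ℕ} (q : Polynomial ℂ) (a : Fin L → Fin L → ℕ) : ℂ :=
  if ∀ i j : Fin L, ¬ i < j → a i j = 0 then
    ∏ p ∈ Finset.univ.filter (fun p : Fin L × Fin L => p.1 < p.2), q.coeff (a p.1 p.2)
  else 0

/-- Coefficient of `z₁^{m 1} ⋯ z_L^{m L}` in
`(∏_{1 ≤ i < j ≤ L} q(z_i/z_j)) F¹(z₁) ⋯ F^L(z_L)`, where `Fⁱ(z) = ∑ₙ (F i n) zⁿ`. -/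
def multiCoeff {W : Type} [AddCommGroup W] [Module ℂ W] (q : Polynomial ℂ) {L : ℕ}
    (F : Fin L → ℤ → Module.End ℂ W) (m : Fin L → ℤ) : Module.End ℂ W :=
  ∑ᶠ a : Fin L → Fin L → ℕ,
    pairWeight q a • (List.ofFn (fun i => F i (m i - shiftIdx a i))).prod

/-- The action of the group algebra `ℂ[M]` on functions `M → X`, where `single s c` acts as
`F ↦ (m ↦ c • F (m - s))`.  Thinking of `F` as the formal distribution `∑ₘ F(m) zᵐ`, this is
multiplication by a Laurent polynomial. -/
def shiftAct (M X : Type) [AddCommGroup M] [AddCommGroup X] [Module ℂ X] :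
    AddMonoidAlgebra ℂ M →ₐ[ℂ] Module.End ℂ (M → X) :=
  AddMonoidAlgebra.lift ℂ _ M
    { toFun := fun s =>
        { toFun := fun F m => F (m - s.toAdd)
          map_add' := fun _ _ => rfl
          map_smul' := fun _ _ => rfl }
      map_one' := by ext F m; simp
      map_mul' := fun s t => by
        refine LinearMap.ext fun F => funext fun m => ?_
        simp [sub_sub] }

section ShiftAct

variable {M N X Y : Type} [AddCommGroup M] [AddCommGroup N]
  [AddCommGroup X] [Module ℂ X] [AddCommGroup Y] [Module ℂ Y]

theorem shiftAct_apply (P : AddMonoidAlgebra ℂ M) (F : M → X) (m : M) :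
    shiftAct M X P F m = P.coeff.sum fun s c => c • F (m - s) := by
  simp [shiftAct, AddMonoidAlgebra.lift_apply, Finsupp.sum, LinearMap.sum_apply,
    Finset.sum_apply]

@[simp]
theorem shiftAct_single (s : M) (c : ℂ) (F : M → X) (m : M) :
    shiftAct M X (AddMonoidAlgebra.single s c) F m = c • F (m - s) := by
  simp [shiftAct]

theorem shiftAct_mul (P Q : AddMonoidAlgebra ℂ M) (F : M → X) :
    shiftAct M X (P * Q) F = shiftAct M X P (shiftAct M X Q F) := by
  rw [map_mul]; rfl

theorem shiftAct_linearMap (T : X →ₗ[ℂ] Y) (P : AddMonoidAlgebra ℂ M) (F : M → X) (m : M) :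
    shiftAct M Y P (fun m => T (F m)) m = T (shiftAct M X P F m) := by
  simp [shiftAct_apply, Finsupp.sum]

theorem shiftAct_mapDomain (σ : M →+ N) (P : AddMonoidAlgebra ℂ M) (F : N → X) (n : N) :
    shiftAct N X (AddMonoidAlgebra.mapDomainAlgHom ℂ ℂ σ P) F n
      = shiftAct M X P (fun s => F (n + σ s)) 0 := by
  induction P using AddMonoidAlgebra.induction_linear with
  | zero => simp
  | add P Q hP hQ => simp only [map_add, LinearMap.add_apply, Pi.add_apply, hP, hQ]
  | single s c => simp [sub_eq_add_neg]

/-- Multiplication by `P` commutes with the pointwise action of a family of linear maps that is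
invariant under the shifts occurring in `P`. -/
theorem shiftAct_mapDomain_comm (σ : N →+ M) (T : M → X →ₗ[ℂ] Y)
    (h : ∀ s m, T (m + σ s) = T m) (P : AddMonoidAlgebra ℂ N) (F : M → X) :
    shiftAct M Y (AddMonoidAlgebra.mapDomainAlgHom ℂ ℂ σ P) (fun m => T m (F m))
      = fun m => T m (shiftAct M X (AddMonoidAlgebra.mapDomainAlgHom ℂ ℂ σ P) F m) := by
  funext m
  simp only [shiftAct_mapDomain, h]
  exact shiftAct_linearMap (T m) P _ 0

end ShiftAct

/-- The substitution `T ↦ e^X`, as an algebra map from Laurent polynomials to power series. -/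
def expSubst : AddMonoidAlgebra ℂ ℤ →ₐ[ℂ] PowerSeries ℂ :=
  AddMonoidAlgebra.lift ℂ _ ℤ
    { toFun := fun m => PowerSeries.rescale ((m.toAdd : ℤ) : ℂ) (PowerSeries.exp ℂ)
      map_one' := by simp
      map_mul' := fun s t => by
        rw [PowerSeries.exp_mul_exp_eq_exp_add]; simp }

theorem coeff_expSubst (b : AddMonoidAlgebra ℂ ℤ) (r : ℕ) :
    PowerSeries.coeff r (expSubst b)
      = b.coeff.sum fun m c => c * ((m : ℂ) ^ r / (r.factorial : ℂ)) := by
  simp [expSubst, AddMonoidAlgebra.lift_apply, Finsupp.sum, PowerSeries.coeff_rescale,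
    PowerSeries.coeff_exp, div_eq_mul_inv]

theorem expSubst_single (m : ℤ) (c : ℂ) :
    expSubst (AddMonoidAlgebra.single m c)
      = c • PowerSeries.rescale (m : ℂ) (PowerSeries.exp ℂ) :=
  AddMonoidAlgebra.lift_single _ _ _

theorem expSubst_injective : Function.Injective expSubst := by
  rw [injective_iff_map_eq_zero]
  intro b hb
  have hpow : ∀ r : ℕ, (b.coeff.sum fun m c => c * (m : ℂ) ^ r) = 0 := fun r => by
    have h := coeff_expSubst b r
    rw [hb, map_zero] at h
    have hr : (r.factorial : ℂ) ≠ 0 := by exact_mod_cast r.factorial_ne_zero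
    simp only [Finsupp.sum, ← mul_div_assoc, ← Finset.sum_div] at h ⊢
    simpa [hr] using h.symm
  have hpoly : ∀ p : Polynomial ℂ, (b.coeff.sum fun m c => c * p.eval (m : ℂ)) = 0 := fun p => by
    simp only [Finsupp.sum, Polynomial.eval_eq_sum, Polynomial.sum, Finset.mul_sum] at hpow ⊢
    rw [Finset.sum_comm]
    refine Finset.sum_eq_zero fun r _ => ?_
    have := congrArg (p.coeff r * ·) (hpow r)
    simpa [Finset.mul_sum, mul_left_comm] using this
  refine LaurentPolynomial.ext fun m => ?_
  by_contra hm
  have hsupp : m ∈ b.coeff.support := by simpa using hm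
  have h := hpoly (∏ k ∈ b.coeff.support.erase m, (Polynomial.X - Polynomial.C (k : ℂ)))
  rw [Finsupp.sum, Finset.sum_eq_single_of_mem m hsupp] at h
  · rw [mul_eq_zero, Polynomial.eval_prod, Finset.prod_eq_zero_iff] at h
    rcases h with h | ⟨k, hk, h⟩
    · exact hm (by simpa using h)
    · simp only [Polynomial.eval_sub, Polynomial.eval_X, Polynomial.eval_C, sub_eq_zero] at h
      exact (Finset.mem_erase.1 hk).1 (by exact_mod_cast h.symm)
  · intro k hk hkm
    rw [Polynomial.eval_prod, Finset.prod_eq_zero (Finset.mem_erase.2 ⟨hkm, hk⟩) (by simp),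
      mul_zero]

theorem intChoose_zero_right (m : ℤ) : intChoose m 0 = 1 := by simp [intChoose]

theorem intChoose_zero_left {i : ℕ} (hi : i ≠ 0) : intChoose 0 i = 0 := by
  rw [intChoose, Finset.prod_eq_zero (Finset.mem_range.2 (Nat.pos_of_ne_zero hi)) (by simp),
    zero_div]

theorem intChoose_neg_one (i : ℕ) : intChoose (-1) i = (-1) ^ i := by
  have h : ∏ j ∈ Finset.range i, (((-1 : ℤ) : ℂ) - (j : ℂ)) = (-1) ^ i * (i.factorial : ℂ) := by
    induction i with
    | zero => simp
    | succ i ih => rw [Finset.prod_range_succ, ih, Nat.factorial_succ]; push_cast; ring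
  rw [intChoose, h, mul_div_assoc, div_self (by exact_mod_cast i.factorial_ne_zero), mul_one]

namespace VertexAlg

variable {V : Type} [AddCommGroup V] [Module ℂ V] (VA : VertexAlg V)

theorem commute_modes {u v : V} (h : ∀ n : ℤ, 0 ≤ n → VA.Y u n v = 0) (m k : ℤ) (w : V) :
    VA.Y u m (VA.Y v k w) = VA.Y v k (VA.Y u m w) := by
  have hY0 : ∀ n, VA.Y 0 n = 0 := fun n => by simpa using VA.Y_smul 0 0 n
  have hb := VA.borcherds u v w m 0 k
  rw [finsum_eq_zero_of_forall_eq_zero (fun i => by rw [h _ (by positivity), hY0]; simp),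
    finsum_eq_single _ 0 (fun i hi => by rw [intChoose_zero_left hi]; simp)] at hb
  simpa [intChoose_zero_right, eq_comm (a := (0 : V)), sub_eq_zero] using hb

theorem mode_pow_apply_eq_zero {u : V} (h : ∀ n : ℤ, 0 ≤ n → VA.Y u n u = 0) (l : ℕ) {n : ℤ}
    (hn : 0 ≤ n) : VA.Y u n ((VA.Y u (-1) ^ l) VA.one) = 0 := by
  induction l with
  | zero => simpa using VA.create u n hn
  | succ l ih => rw [pow_succ', Module.End.mul_apply, VA.commute_modes h, ih, map_zero]

/-- Skew symmetry `Y(u,z)v = e^{z𝒟} Y(v,-z)u`, in the case of no singular terms. -/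
theorem skew_symmetry {u v : V} (h : ∀ n : ℤ, 0 ≤ n → VA.Y u n v = 0) (t : ℕ) :
    VA.Y v (-1 - t) u = ∑ p ∈ Finset.HasAntidiagonal.antidiagonal t,
      (-1 : ℂ) ^ p.2 • VA.Y (VA.Y u (-1 - p.2) v) (-1 - p.1) VA.one := by
  have hY0 : ∀ n, VA.Y 0 n = 0 := fun n => by simpa using VA.Y_smul 0 0 n
  have hb := VA.borcherds u v VA.one (-1) (-1 - t) 0
  rw [finsum_eq_sum_of_support_subset (s := Finset.range (t + 1)) _ (fun i hi => by
      by_contra hi'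
      simp only [Finset.coe_range, Set.mem_Iio, not_lt] at hi'
      exact hi (by simp only [h _ (show (0 : ℤ) ≤ -1 - t + i by omega), hY0]; simp)),
    finsum_eq_single _ 0 (fun i hi => by
      rw [VA.create v _ (by positivity), VA.create u _ (by omega)]; simp)] at hb
  have hsign : (-1 : ℂ) ^ (-1 - t : ℤ) = -(-1) ^ t := by
    rw [sub_eq_add_neg, zpow_add₀ (by simp), zpow_neg _ (t : ℤ), zpow_natCast, ← inv_pow]
    norm_num
  simp only [intChoose_neg_one, intChoose_zero_right, VA.create v 0 le_rfl, hsign,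
    VA.create_neg_one, pow_zero, Nat.cast_zero, add_zero, sub_zero, mul_one, one_smul, map_zero,
    zero_sub, neg_smul, neg_neg] at hb
  have hb' := congrArg ((-1 : ℂ) ^ t • ·) hb
  simp only [smul_smul, ← mul_pow, mul_neg, neg_neg, mul_one, one_pow, one_smul,
    Finset.smul_sum] at hb'
  rw [← hb', Finset.Nat.sum_antidiagonal_eq_sum_range_succ_mk]
  refine Finset.sum_congr rfl fun i hi => ?_
  have hi' : i ≤ t := Nat.lt_succ_iff.1 (Finset.mem_range.1 hi)
  have hpow : (-1 : ℂ) ^ t * (-1) ^ i = (-1) ^ (t - i) := by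
    conv_lhs => rw [← Nat.sub_add_cancel hi', pow_add, mul_assoc, ← mul_pow]
    simp
  rw [hpow]
  congr 3
  congr 1; push_cast [hi']; ring_nf

end VertexAlg

/-- The exponent homomorphism of the monomial `z₁/z₂`. -/
def ratioHom : ℤ →+ ℤ × ℤ := (AddMonoidHom.id ℤ).prod (-AddMonoidHom.id ℤ)

@[simp]
theorem ratioHom_apply (i : ℤ) : ratioHom i = (i, -i) := rfl

/-- Evaluation of a polynomial at the Laurent monomial with exponent homomorphism `σ`. -/
def evalMonomial {M : Type} [AddCommGroup M] (σ : ℤ →+ M) :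
    Polynomial ℂ →ₐ[ℂ] AddMonoidAlgebra ℂ M :=
  (AddMonoidAlgebra.mapDomainAlgHom ℂ ℂ σ).comp Polynomial.toLaurentAlg

theorem evalMonomial_eq {M : Type} [AddCommGroup M] (σ : ℤ →+ M) (f : Polynomial ℂ) :
    evalMonomial σ f = AddMonoidAlgebra.mapDomainAlgHom ℂ ℂ σ (Polynomial.toLaurent f) := rfl

theorem toLaurent_eq_sum (f : Polynomial ℂ) :
    Polynomial.toLaurent f
      = ∑ i ∈ f.support, (AddMonoidAlgebra.single (i : ℤ) (f.coeff i) : AddMonoidAlgebra ℂ ℤ) := by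
  conv_lhs => rw [f.as_sum_support, map_sum]
  refine Finset.sum_congr rfl fun i _ => ?_
  rw [← Polynomial.C_mul_X_pow_eq_monomial, Polynomial.toLaurent_C_mul_X_pow,
    LaurentPolynomial.single_eq_C_mul_T]

theorem evalMonomial_eq_sum {M : Type} [AddCommGroup M] (σ : ℤ →+ M) (f : Polynomial ℂ) :
    evalMonomial σ f = ∑ i ∈ f.support, AddMonoidAlgebra.single (σ i) (f.coeff i) := by
  rw [evalMonomial_eq, toLaurent_eq_sum, map_sum]
  exact Finset.sum_congr rfl fun i _ => AddMonoidAlgebra.mapDomain_single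

/-- `F(z₁,z₂)` lies in `X((z₁,z₂))`. -/
def LowerBdd {X : Type} [Zero X] (F : ℤ × ℤ → X) : Prop :=
  ∃ N : ℤ, ∀ m k : ℤ, (m < N ∨ k < N) → F (m, k) = 0

/-- The product `A(z₁)B(z₂)` of two fields, as a formal distribution. -/
def fieldProd {W : Type} [AddCommGroup W] [Module ℂ W] (A B : ℤ → Module.End ℂ W) :
    ℤ × ℤ → Module.End ℂ W :=
  fun p => A p.1 * B p.2

theorem pCoeff2_eq {W : Type} [AddCommGroup W] [Module ℂ W] (A B : ℤ → Module.End ℂ W)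
    (f : Polynomial ℂ) (m k : ℤ) :
    pCoeff2 A B f m k = shiftAct _ _ (evalMonomial ratioHom f) (fieldProd A B) (m, k) := by
  simp [evalMonomial_eq_sum, map_sum, pCoeff2, fieldProd, LinearMap.sum_apply, Finset.sum_apply]

theorem coeff_expSubst_toLaurent (f : Polynomial ℂ) (s : ℕ) :
    PowerSeries.coeff s (expSubst (Polynomial.toLaurent f))
      = ∑ i ∈ f.support, f.coeff i * expC i s := by
  simp only [toLaurent_eq_sum, map_sum, expSubst_single, map_smul, PowerSeries.coeff_rescale,
    PowerSeries.coeff_exp, expC]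
  simp [div_eq_mul_inv]

/-- `b` is the part of total degree `n` of `F(z₁,z₂)`, as a Laurent polynomial in `z₁/z₂`. -/
def IsDiagonal (F : ℤ × ℤ → ℂ) (n : ℤ) (b : AddMonoidAlgebra ℂ ℤ) : Prop :=
  ∀ m, b.coeff m = F (m, n - m)

theorem IsDiagonal.mul {F : ℤ × ℤ → ℂ} {n : ℤ} {b : AddMonoidAlgebra ℂ ℤ}
    (hb : IsDiagonal F n b) (g : AddMonoidAlgebra ℂ ℤ) :
    IsDiagonal (shiftAct _ _ (AddMonoidAlgebra.mapDomainAlgHom ℂ ℂ ratioHom g) F) n (g * b) := by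
  intro m
  induction g using AddMonoidAlgebra.induction_linear with
  | zero => simp
  | add P Q hP hQ => simp only [add_mul, AddMonoidAlgebra.coeff_add, Finsupp.add_apply, hP, hQ, map_add,
      LinearMap.add_apply, Pi.add_apply]
  | single s c =>
    rw [AddMonoidAlgebra.coeff_single_mul_apply, hb, shiftAct_mapDomain, shiftAct_single]
    simp only [ratioHom_apply, smul_eq_mul]
    congr 2
    ext <;> simp <;> ring

theorem LowerBdd.exists_isDiagonal {F : ℤ × ℤ → ℂ} (hF : LowerBdd F) (n : ℤ) :
    ∃ b, IsDiagonal F n b := by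
  obtain ⟨N, hN⟩ := hF
  have hfin : (Function.support fun m => F (m, n - m)).Finite := by
    refine (Set.finite_Icc N (n - N)).subset fun m hm => ?_
    by_contra hm'
    simp only [Set.mem_Icc, not_and_or, not_le] at hm'
    exact hm (hN _ _ (by omega))
  exact ⟨AddMonoidAlgebra.ofCoeff (Finsupp.ofSupportFinite _ hfin), fun m => rfl⟩

theorem IsDiagonal.coeff_expSubst {F : ℤ × ℤ → ℂ} {n : ℤ} {b : AddMonoidAlgebra ℂ ℤ}
    (hb : IsDiagonal F n b) (r : ℕ) :
    PowerSeries.coeff r (expSubst b) = ∑ᶠ m : ℤ, subC m r * F (m, n - m) := by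
  rw [_root_.coeff_expSubst, finsum_eq_sum_of_support_subset (s := b.coeff.support) _ fun m hm => by
    simp only [Function.mem_support] at hm
    simpa [hb m] using right_ne_zero_of_mul hm]
  refine Finset.sum_congr rfl fun m _ => ?_
  rw [← hb m, subC]
  simp [mul_comm]

/-- Matrix coefficients of endomorphisms. -/
def matCoeff {W : Type} [AddCommGroup W] [Module ℂ W] (φ : Module.Dual ℂ W) (w : W) :
    Module.End ℂ W →ₗ[ℂ] ℂ :=
  φ.comp (LinearMap.applyₗ w)

@[simp]
theorem matCoeff_apply {W : Type} [AddCommGroup W] [Module ℂ W] (φ : Module.Dual ℂ W) (w : W)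
    (T : Module.End ℂ W) : matCoeff φ w T = φ (T w) := rfl

theorem LowerBdd.matCoeff {W : Type} [AddCommGroup W] [Module ℂ W]
    {F : ℤ × ℤ → Module.End ℂ W} {w : W} (hF : LowerBdd fun p => F p w) (φ : Module.Dual ℂ W) :
    LowerBdd fun p => matCoeff φ w (F p) := by
  obtain ⟨N, hN⟩ := hF
  exact ⟨N, fun m k h => by simp only [matCoeff_apply, hN m k h, map_zero]⟩

theorem eq_of_isDiagonal_matCoeff {W : Type} [AddCommGroup W] [Module ℂ W]
    {F F' : ℤ × ℤ → Module.End ℂ W}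
    (h : ∀ (φ : Module.Dual ℂ W) (w : W) (n : ℤ), ∃ b,
      IsDiagonal (fun p => matCoeff φ w (F p)) n b ∧
        IsDiagonal (fun p => matCoeff φ w (F' p)) n b) : F = F' := by
  funext ⟨m, k⟩
  refine LinearMap.ext fun w => ?_
  rw [← sub_eq_zero, ← Module.forall_dual_apply_eq_zero_iff ℂ]
  intro φ
  obtain ⟨b, hb, hb'⟩ := h φ w (m + k)
  have h1 := hb m
  have h2 := hb' m
  simp only [add_sub_cancel_left, matCoeff_apply] at h1 h2
  rw [map_sub, ← h1, ← h2, sub_self]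

namespace PhiMod

variable {V W : Type} [AddCommGroup V] [Module ℂ V] [AddCommGroup W] [Module ℂ W]
  {G : Type} [Group G] {VA : VertexAlg V} {ρ : G →* (V ≃ₗ[ℂ] V)} {χ : G →* ℂˣ}
  (M : PhiMod VA ρ χ W)

theorem E_zero (n : ℤ) : M.E 0 n = 0 := by simpa using M.E_smul 0 0 n

/-- The product `f(z₁/z₂) Y_W(a,z₁) Y_W(b,z₂)`. -/
def twisted (f : Polynomial ℂ) (a b : V) : ℤ × ℤ → Module.End ℂ W :=
  shiftAct _ _ (evalMonomial ratioHom f) (fieldProd (M.E a) (M.E b))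

theorem twisted_mul (f g : Polynomial ℂ) (a b : V) :
    M.twisted (f * g) a b = shiftAct _ _ (evalMonomial ratioHom f) (M.twisted g a b) := by
  rw [twisted, map_mul, shiftAct_mul]; rfl

theorem isDiagonal_twisted_mul {f g : Polynomial ℂ} {a b : V} {φ : Module.Dual ℂ W} {w : W}
    {n : ℤ} {β : AddMonoidAlgebra ℂ ℤ}
    (hβ : IsDiagonal (fun p => matCoeff φ w (M.twisted g a b p)) n β) :
    IsDiagonal (fun p => matCoeff φ w (M.twisted (f * g) a b p)) n
      (Polynomial.toLaurent f * β) := by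
  convert hβ.mul (Polynomial.toLaurent f) using 1
  funext p
  rw [M.twisted_mul, ← shiftAct_linearMap]; rfl

/-- The generating series `∑ₜ ⟨φ, Y_W(a_{-1-t} b, z₂) w⟩ z₀ᵗ` at `z₂ⁿ`. -/
def iterateSeries (a b : V) (φ : Module.Dual ℂ W) (w : W) (n : ℤ) : PowerSeries ℂ :=
  PowerSeries.mk fun t => φ (M.E (VA.Y a (-1 - t) b) n w)

/-- If `Y(a,z)b` has no singular terms, then on each total degree where
`h(z₁/z₂)Y_W(a,z₁)Y_W(b,z₂)` is a Laurent polynomial, its substitution `z₁ = z₂e^{z₀}` is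
`h(e^{z₀})Y_W(Y(a,z₀)b,z₂)`. -/
theorem expSubst_twisted {a b : V} (hab : ∀ n : ℤ, 0 ≤ n → VA.Y a n b = 0) {h : Polynomial ℂ}
    {w : W} {φ : Module.Dual ℂ W} {n : ℤ}
    {β : AddMonoidAlgebra ℂ ℤ}
    (hβ : IsDiagonal (fun p => matCoeff φ w (M.twisted h a b p)) n β) :
    expSubst β = expSubst (Polynomial.toLaurent h) * M.iterateSeries a b φ w n := by
  obtain ⟨f, hf0, -, hfB, hfA⟩ := M.assoc a b
  simp only [pCoeff2_eq] at hfB hfA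
  have hBf : LowerBdd fun p => M.twisted f a b p w := hfB w
  obtain ⟨γ, hγ⟩ := (hBf.matCoeff φ).exists_isDiagonal n
  have hγS : expSubst γ = expSubst (Polynomial.toLaurent f) * M.iterateSeries a b φ w n := by
    ext r
    have hr := congrArg φ (hfA r n w)
    obtain ⟨N, hN⟩ := hBf
    have hout : ∀ m, m ∉ Finset.Icc N (n - N) → M.twisted f a b (m, n - m) w = 0 := fun m hm => by
      rw [Finset.mem_Icc, not_and_or, not_le, not_le] at hm
      exact hN _ _ (by omega)
    have hjout : ∀ j, j ∉ (Finset.range (r + 1)).image (fun t : ℕ => (-1 - t : ℤ)) →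
        (∑ i ∈ f.support, f.coeff i * expC i (r + j + 1)) • M.E (VA.Y a j b) n w = 0 := by
      intro j hj
      rcases lt_or_ge j 0 with hj0 | hj0
      · have h2 : ¬ 0 ≤ (r : ℤ) + j + 1 := fun h2 => hj <| by
          rw [Finset.mem_image]
          exact ⟨(-1 - j).toNat, Finset.mem_range.2 (by omega), by omega⟩
        simp [expC, h2]
      · rw [hab j hj0, M.E_zero, LinearMap.zero_apply, smul_zero]
    rw [finsum_eq_sum_of_support_subset _ (fun j hj => by
        by_contra hj'; exact hj (hjout j hj')),
      finsum_eq_sum_of_support_subset (s := Finset.Icc N (n - N)) _ (fun m hm => by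
        by_contra hm'
        refine hm ?_
        have := hout m hm'
        rw [twisted] at this
        simp only [this, smul_zero])] at hr
    rw [hγ.coeff_expSubst, finsum_eq_sum_of_support_subset (s := Finset.Icc N (n - N)) _
      (fun m hm => by
        by_contra hm'
        exact hm (by simp only [matCoeff_apply, hout m hm', map_zero, mul_zero]))]
    simp only [map_sum, map_smul, smul_eq_mul] at hr
    refine hr.symm.trans ?_
    rw [Finset.sum_image (fun x _ y _ hxy => by simpa using hxy), PowerSeries.coeff_mul,
      ← Finset.Nat.sum_antidiagonal_swap, Finset.Nat.sum_antidiagonal_eq_sum_range_succ_mk]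
    refine Finset.sum_congr rfl fun t ht => ?_
    have ht' : t ≤ r := Nat.lt_succ_iff.1 (Finset.mem_range.1 ht)
    simp only [Prod.swap, coeff_expSubst_toLaurent, iterateSeries, PowerSeries.coeff_mk,
      Nat.cast_sub ht', show (r : ℤ) + (-1 - t) + 1 = r - t by ring]
  have hinj : expSubst (Polynomial.toLaurent f) ≠ 0 := by
    rw [Ne, map_eq_zero_iff _ expSubst_injective]
    exact Polynomial.toLaurent_ne_zero.2 hf0
  refine mul_left_cancel₀ hinj ?_
  have h1 := M.isDiagonal_twisted_mul (f := f) hβ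
  have h2 := M.isDiagonal_twisted_mul (f := h) hγ
  rw [mul_comm h f] at h2
  rw [← map_mul, show Polynomial.toLaurent f * β = Polynomial.toLaurent h * γ from
    LaurentPolynomial.ext fun m => (h1 m).trans (h2 m).symm, map_mul, hγS, mul_left_comm]

/-- `Y_W(e^{z₀𝒟}a, z) = Y_W(a, z e^{z₀})`. -/
theorem E_creation (a : V) (n : ℤ) (i : ℕ) :
    M.E (VA.Y a (-1 - i) VA.one) n = ((n : ℂ) ^ i / (i.factorial : ℂ)) • M.E a n := by
  refine LinearMap.ext fun w => ?_
  rw [← sub_eq_zero, ← Module.forall_dual_apply_eq_zero_iff ℂ]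
  intro φ
  have hval : ∀ p : ℤ × ℤ, M.twisted 1 a VA.one p w = if p.2 = 0 then M.E a p.1 w else 0 := by
    intro p
    simp only [twisted, map_one, Module.End.one_apply, fieldProd, M.vacuum]
    split_ifs <;> simp
  have hβ : IsDiagonal (fun p => matCoeff φ w (M.twisted 1 a VA.one p)) n
      (AddMonoidAlgebra.single n (φ (M.E a n w))) := by
    intro m
    simp only [matCoeff_apply, hval, AddMonoidAlgebra.coeff_single, Finsupp.single_apply,
      sub_eq_zero]
    split_ifs with h <;> simp [h]
  have h := congrArg (PowerSeries.coeff i)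
    (M.expSubst_twisted (fun n hn => VA.create a n hn) hβ)
  rw [map_one, map_one, one_mul, expSubst_single, iterateSeries, PowerSeries.coeff_mk, map_smul,
    PowerSeries.coeff_rescale, PowerSeries.coeff_exp] at h
  rw [map_sub, ← h, LinearMap.smul_apply, map_smul, sub_eq_zero]
  simp [div_eq_mul_inv, mul_comm]

end PhiMod

theorem constantCoeff_expSubst_toLaurent (f : Polynomial ℂ) :
    PowerSeries.coeff 0 (expSubst (Polynomial.toLaurent f)) = f.eval 1 := by
  have h := coeff_expSubst_toLaurent f 0
  rw [h, Polynomial.eval_eq_sum, Polynomial.sum]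
  simp [expC]

namespace PhiMod

variable {V W : Type} [AddCommGroup V] [Module ℂ V] [AddCommGroup W] [Module ℂ W]
  {G : Type} [Group G] {VA : VertexAlg V} {ρ : G →* (V ≃ₗ[ℂ] V)} {χ : G →* ℂˣ}
  (M : PhiMod VA ρ χ W)

theorem twisted_lower_trunc (h : Polynomial ℂ) (a b : V) (w : W) :
    ∃ K : ℤ, ∀ m k : ℤ, k < K → M.twisted h a b (m, k) w = 0 := by
  obtain ⟨K, hK⟩ := M.lower_trunc b w
  refine ⟨K - h.natDegree, fun m k hk => ?_⟩
  rw [twisted, ← pCoeff2_eq, pCoeff2, LinearMap.sum_apply]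
  refine Finset.sum_eq_zero fun i hi => ?_
  have hi' := Polynomial.le_natDegree_of_mem_supp i hi
  rw [LinearMap.smul_apply, Module.End.mul_apply, hK _ (by omega), map_zero, smul_zero]

theorem twisted_sub_one_mul (h : Polynomial ℂ) (a b : V) (m k : ℤ) :
    M.twisted ((Polynomial.X - 1) * h) a b (m, k)
      = M.twisted h a b (m - 1, k + 1) - M.twisted h a b (m, k) := by
  have hX : evalMonomial ratioHom Polynomial.X = AddMonoidAlgebra.single (1, -1) 1 := by
    simp [evalMonomial_eq_sum, Polynomial.support_X]
  rw [twisted_mul, map_sub, map_one, hX]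
  simp

/-- A factor `z₁/z₂ - 1` can be cancelled when `Y(a,z)b` has no singular terms. -/
theorem lowerBdd_twisted_of_sub_one_mul {a b : V} (hab : ∀ n : ℤ, 0 ≤ n → VA.Y a n b = 0)
    {h : Polynomial ℂ} {w : W}
    (hB : LowerBdd fun p => M.twisted ((Polynomial.X - 1) * h) a b p w) :
    LowerBdd fun p => M.twisted h a b p w := by
  obtain ⟨K, hK⟩ := M.twisted_lower_trunc h a b w
  obtain ⟨N, hN⟩ := id hB
  refine ⟨N, fun m k hmk => ?_⟩
  rw [← Module.forall_dual_apply_eq_zero_iff ℂ]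
  intro φ
  obtain ⟨n, rfl⟩ : ∃ n, k = n - m := ⟨m + k, by ring⟩
  obtain ⟨β, hβ⟩ := (hB.matCoeff φ).exists_isDiagonal n
  have hβ0 : ∀ j, j < N ∨ n - N < j → β.coeff j = 0 := fun j hj => by
    exact (hβ j).trans ((congrArg φ (hN _ _ (by omega))).trans (map_zero φ))
  have htel : ∀ t : ℕ, φ (M.twisted h a b (m, n - m) w)
      = ∑ i ∈ Finset.range t, β.coeff (m + 1 + i)
        + φ (M.twisted h a b (m + t, n - (m + t)) w) := by
    intro t
    induction t with
    | zero => simp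
    | succ t ih =>
      rw [ih, Finset.sum_range_succ, hβ]
      simp only [matCoeff_apply]
      rw [M.twisted_sub_one_mul, LinearMap.sub_apply,
        map_sub]
      push_cast
      rw [show m + 1 + (t : ℤ) - 1 = m + t by ring,
        show n - (m + 1 + (t : ℤ)) + 1 = n - (m + t) by ring,
        show m + 1 + (t : ℤ) = m + (t + 1) by ring]
      ring
  set t := (max (n - K) (n - N) + 1 - m).toNat
  have ht : max (n - K) (n - N) < m + t := by omega
  rw [htel t, hK _ _ (by omega), map_zero, add_zero]
  by_cases hm : m < N
  · have hsum : ∑ j ∈ β.coeff.support, β.coeff j = 0 := by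
      have h0 := congrArg (PowerSeries.coeff 0) (M.expSubst_twisted hab hβ)
      rw [PowerSeries.coeff_mul, Finset.Nat.antidiagonal_zero, Finset.sum_singleton,
        constantCoeff_expSubst_toLaurent, coeff_expSubst] at h0
      simpa [Finsupp.sum] using h0
    rw [← hsum, ← Finset.sum_image (f := β.coeff) (g := fun i : ℕ => m + 1 + (i : ℤ))
      (fun x _ y _ hxy => by simpa using hxy)]
    refine (Finset.sum_subset (fun j hj => ?_) fun j _ hj => by simpa using hj).symm
    have hj1 : N ≤ j ∧ j ≤ n - N := by
      by_contra hj'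
      exact (Finsupp.mem_support_iff.1 hj) (hβ0 j (by omega))
    exact Finset.mem_image.2 ⟨(j - (m + 1)).toNat, Finset.mem_range.2 (by omega), by omega⟩
  · exact Finset.sum_eq_zero fun i _ => hβ0 _ (by omega)

/-- When `Y(a,z)b` has no singular terms, the polynomial in the associativity relation can be
chosen without the root `1`. -/
theorem exists_lowerBdd_twisted {a b : V} (hab : ∀ n : ℤ, 0 ≤ n → VA.Y a n b = 0) :
    ∃ q : Polynomial ℂ, q ≠ 0 ∧
      (∀ c : ℂ, q.IsRoot c → (∃ g : G, ((χ g : ℂ)) = c) ∧ c ≠ 1) ∧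
      ∀ w, LowerBdd fun p => M.twisted q a b p w := by
  obtain ⟨f, hf0, hfr, hfB, -⟩ := M.assoc a b
  obtain ⟨q, hq, hq1⟩ := Polynomial.exists_eq_pow_rootMultiplicity_mul_and_not_dvd f hf0 1
  have hq0 : q ≠ 0 := fun h => hq1 (h ▸ dvd_zero _)
  refine ⟨q, hq0, fun c hc => ⟨hfr c ?_, fun h1 => hq1 ?_⟩, fun w => ?_⟩
  · rw [hq, Polynomial.IsRoot, Polynomial.eval_mul, hc.eq_zero, mul_zero]
  · rwa [Polynomial.dvd_iff_isRoot, ← h1]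
  · have hB : LowerBdd fun p => M.twisted f a b p w := by
      simp only [pCoeff2_eq] at hfB
      exact hfB w
    rw [hq] at hB
    generalize f.rootMultiplicity 1 = k at hB
    induction k with
    | zero => simpa using hB
    | succ k ih =>
      refine ih (M.lowerBdd_twisted_of_sub_one_mul hab ?_)
      rwa [pow_succ', mul_assoc, map_one] at hB

end PhiMod

theorem invert_single (m : ℤ) (c : ℂ) :
    LaurentPolynomial.invert (AddMonoidAlgebra.single m c : LaurentPolynomial ℂ)
      = AddMonoidAlgebra.single (-m) c :=
  AddMonoidAlgebra.domCongr_single ..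

theorem expSubst_invert (b : AddMonoidAlgebra ℂ ℤ) :
    expSubst (LaurentPolynomial.invert b) = PowerSeries.rescale (-1) (expSubst b) := by
  induction b using AddMonoidAlgebra.induction_linear with
  | zero => simp
  | add P Q hP hQ => rw [map_add, map_add, hP, hQ, map_add, map_add]
  | single s c =>
    rw [invert_single, expSubst_single, expSubst_single]
    ext r
    simp only [map_smul, PowerSeries.coeff_rescale, smul_eq_mul, Int.cast_neg]
    rw [← neg_one_mul (s : ℂ), mul_pow]
    ring

theorem shiftAct_ratioHom_swap {X : Type} [AddCommGroup X] [Module ℂ X]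
    (P : AddMonoidAlgebra ℂ ℤ) (F : ℤ × ℤ → X) (p : ℤ × ℤ) :
    shiftAct _ _ (AddMonoidAlgebra.mapDomainAlgHom ℂ ℂ ratioHom P) F p.swap
      = shiftAct _ _ (AddMonoidAlgebra.mapDomainAlgHom ℂ ℂ ratioHom (LaurentPolynomial.invert P))
          (fun s => F s.swap) p := by
  induction P using AddMonoidAlgebra.induction_linear with
  | zero => simp
  | add P Q hP hQ => simp only [map_add, LinearMap.add_apply, Pi.add_apply, hP, hQ]
  | single s c =>
    rw [invert_single]
    simp only [shiftAct_mapDomain, shiftAct_single]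
    congr 2
    ext <;> simp

theorem IsDiagonal.swap {F : ℤ × ℤ → ℂ} {n : ℤ} {b : AddMonoidAlgebra ℂ ℤ}
    (hb : IsDiagonal F n b) :
    IsDiagonal (fun p => F p.swap) n
      (AddMonoidAlgebra.single n 1 * LaurentPolynomial.invert b) := by
  intro m
  rw [AddMonoidAlgebra.coeff_single_mul_apply, one_mul, LaurentPolynomial.invert_apply, hb]
  simp only [Prod.swap]
  congr 2 <;> ring

theorem reverse_root {q : Polynomial ℂ} (hq : q ≠ 0) {c : ℂ} (hc : q.reverse.IsRoot c) :
    c ≠ 0 ∧ q.IsRoot c⁻¹ := by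
  have hc0 : c ≠ 0 := by
    rintro rfl
    rw [Polynomial.IsRoot, ← Polynomial.coeff_zero_eq_eval_zero, Polynomial.coeff_zero_reverse,
      Polynomial.leadingCoeff_eq_zero] at hc
    exact hq hc
  refine ⟨hc0, ?_⟩
  let : Invertible c⁻¹ := invertibleOfNonzero (inv_ne_zero hc0)
  have h := (Polynomial.eval₂_reverse_eq_zero_iff (RingHom.id ℂ) c⁻¹ q).1
  rw [invOf_eq_inv, inv_inv] at h
  exact h hc

namespace PhiMod

variable {V W : Type} [AddCommGroup V] [Module ℂ V] [AddCommGroup W] [Module ℂ W]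
  {G : Type} [Group G] {VA : VertexAlg V} {ρ : G →* (V ≃ₗ[ℂ] V)} {χ : G →* ℂˣ}
  (M : PhiMod VA ρ χ W)

theorem E_sum_smul {ι : Type} (s : Finset ι) (c : ι → ℂ) (v : ι → V) (n : ℤ) :
    M.E (∑ i ∈ s, c i • v i) n = ∑ i ∈ s, c i • M.E (v i) n := by
  induction s using Finset.cons_induction with
  | empty => simp [M.E_zero]
  | cons i s hi ih => rw [Finset.sum_cons, Finset.sum_cons, M.E_add, M.E_smul, ih]

theorem iterateSeries_skew {u : V} (hu : ∀ n : ℤ, 0 ≤ n → VA.Y u n u = 0)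
    (φ : Module.Dual ℂ W) (w : W) (n : ℤ) :
    PowerSeries.rescale (n : ℂ) (PowerSeries.exp ℂ)
        * PowerSeries.rescale (-1) (M.iterateSeries u u φ w n)
      = M.iterateSeries u u φ w n := by
  ext t
  simp only [PowerSeries.coeff_mul, PowerSeries.coeff_rescale, iterateSeries,
    PowerSeries.coeff_mk, PowerSeries.coeff_exp]
  rw [VA.skew_symmetry hu t, M.E_sum_smul, LinearMap.sum_apply, map_sum]
  refine Finset.sum_congr rfl fun p _ => ?_
  rw [M.E_creation]
  simp [div_eq_mul_inv]
  ring

theorem exists_local {u : V} (hu : ∀ n : ℤ, 0 ≤ n → VA.Y u n u = 0) :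
    ∃ q : Polynomial ℂ, q ≠ 0 ∧
      (∀ c : ℂ, q.IsRoot c → (∃ g : G, ((χ g : ℂ)) = c) ∧ c ≠ 1) ∧
      shiftAct _ _ (evalMonomial ratioHom q) (fun p => M.E u p.1 * M.E u p.2)
        = shiftAct _ _ (evalMonomial ratioHom q) (fun p => M.E u p.2 * M.E u p.1) := by
  obtain ⟨q, hq0, hqr, hB⟩ := M.exists_lowerBdd_twisted hu
  refine ⟨q.reverse * q, mul_ne_zero (by rwa [Ne, Polynomial.reverse_eq_zero]) hq0,
    fun c hc => ?_, ?_⟩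
  · rw [Polynomial.IsRoot, Polynomial.eval_mul, mul_eq_zero] at hc
    rcases hc with hc | hc
    · obtain ⟨-, hc⟩ := reverse_root hq0 hc
      obtain ⟨⟨g, hg⟩, h1⟩ := hqr _ hc
      exact ⟨⟨g⁻¹, by rw [map_inv, Units.val_inv_eq_inv_val, hg, inv_inv]⟩,
        fun h => h1 (by rw [h, inv_one])⟩
    · exact hqr c hc
  · set Q : AddMonoidAlgebra ℂ ℤ := Polynomial.toLaurent q
    set R : AddMonoidAlgebra ℂ ℤ := Polynomial.toLaurent q.reverse
    set T : AddMonoidAlgebra ℂ ℤ := LaurentPolynomial.T q.natDegree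
    have hR : R = LaurentPolynomial.invert Q * T := LaurentPolynomial.toLaurent_reverse q
    have hl : shiftAct _ _ (evalMonomial ratioHom (q.reverse * q))
        (fun p => M.E u p.1 * M.E u p.2)
          = shiftAct _ _ (AddMonoidAlgebra.mapDomainAlgHom ℂ ℂ ratioHom R) (M.twisted q u u) :=
      M.twisted_mul q.reverse q u u
    have hr : shiftAct _ _ (evalMonomial ratioHom (q.reverse * q))
        (fun p => M.E u p.2 * M.E u p.1)
          = shiftAct _ _ (AddMonoidAlgebra.mapDomainAlgHom ℂ ℂ ratioHom (Q * T))
            (fun p => M.twisted q u u p.swap) := by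
      have hswap : (fun p => M.twisted q u u p.swap) = shiftAct _ _
          (AddMonoidAlgebra.mapDomainAlgHom ℂ ℂ ratioHom (LaurentPolynomial.invert Q))
          (fun p => M.E u p.2 * M.E u p.1) :=
        funext fun p => shiftAct_ratioHom_swap Q _ p
      rw [hswap, ← shiftAct_mul, ← map_mul, evalMonomial_eq, map_mul]
      have hRQ : R * Q = Q * T * LaurentPolynomial.invert Q := by rw [hR]; ring
      rw [← hRQ]
    rw [hl, hr]
    refine eq_of_isDiagonal_matCoeff fun φ w n => ?_
    obtain ⟨β, hβ⟩ := ((hB w).matCoeff φ).exists_isDiagonal n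
    have h1 := hβ.mul R
    have h2 := hβ.swap.mul (Q * T)
    have hexp := M.expSubst_twisted hu hβ
    have hβ' : R * β = Q * T * (AddMonoidAlgebra.single n 1 * LaurentPolynomial.invert β) := by
      apply expSubst_injective
      simp only [hR, map_mul, expSubst_invert, hexp, expSubst_single, one_smul]
      conv_lhs => rw [← M.iterateSeries_skew hu φ w n]
      ring
    refine ⟨R * β, ?_, ?_⟩
    · convert h1 using 1
      funext p
      exact (shiftAct_linearMap (matCoeff φ w) _ _ p).symm
    · rw [hβ']
      convert h2 using 1
      funext p
      exact (shiftAct_linearMap (matCoeff φ w) _ _ p).symm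

end PhiMod

section Multi

variable {ι : Type} [DecidableEq ι]

/-- Exponent homomorphism of the monomial `z_i/z_j`. -/
def pairHom (i j : ι) : ℤ →+ (ι → ℤ) :=
  AddMonoidHom.single (fun _ => ℤ) i - AddMonoidHom.single (fun _ => ℤ) j

@[simp]
theorem pairHom_apply (i j : ι) (k : ℤ) :
    pairHom i j k = Pi.single i k - Pi.single j k := rfl

theorem prod_single_eq {M : Type} [AddCommGroup M] {κ : Type} (s : Finset κ) (f : κ → M)
    (c : κ → ℂ) :
    ∏ x ∈ s, (AddMonoidAlgebra.single (f x) (c x) : AddMonoidAlgebra ℂ M)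
      = AddMonoidAlgebra.single (∑ x ∈ s, f x) (∏ x ∈ s, c x) := by
  classical
  induction s using Finset.induction_on with
  | empty => rfl
  | insert x s hx ih =>
    rw [Finset.prod_insert hx, Finset.sum_insert hx, Finset.prod_insert hx, ih,
      AddMonoidAlgebra.single_mul_single]

/-- `∏_{i<j} q(z_i/z_j)` as a Laurent polynomial. -/
def pairProd (q : Polynomial ℂ) (L : ℕ) : AddMonoidAlgebra ℂ (Fin L → ℤ) :=
  ∏ p ∈ Finset.univ.filter (fun p : Fin L × Fin L => p.1 < p.2), evalMonomial (pairHom p.1 p.2) q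

theorem multiCoeff_eq {W : Type} [AddCommGroup W] [Module ℂ W] (q : Polynomial ℂ) {L : ℕ}
    (F : Fin L → ℤ → Module.End ℂ W) (m : Fin L → ℤ) :
    multiCoeff q F m
      = shiftAct _ _ (pairProd q L) (fun m => (List.ofFn fun i => F i (m i)).prod) m := by
  classical
  set Q : Fin L → Fin L → Polynomial ℂ := fun i j => if i < j then q else 1
  have hQ1 : ∀ i j, ¬ i < j → Q i j = 1 := fun i j h => if_neg h
  have hQ2 : ∀ i j, i < j → Q i j = q := fun i j h => if_pos h
  have hP : pairProd q L = ∑ a ∈ Fintype.piFinset fun i => Fintype.piFinset fun j =>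
      (Q i j).support, AddMonoidAlgebra.single (∑ i, ∑ j, pairHom i j (a i j))
        (∏ i, ∏ j, (Q i j).coeff (a i j)) := by
    have h1 : pairProd q L = ∏ i, ∏ j, evalMonomial (pairHom i j) (Q i j) := by
      rw [pairProd, Finset.prod_filter, ← Finset.univ_product_univ, Finset.prod_product]
      refine Finset.prod_congr rfl fun i _ => Finset.prod_congr rfl fun j _ => ?_
      by_cases h : i < j
      · rw [hQ2 i j h, if_pos h]
      · rw [hQ1 i j h, if_neg h, map_one]
    rw [h1]
    simp only [evalMonomial_eq_sum, Finset.prod_univ_sum, prod_single_eq]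
  have hsupp : ∀ a : Fin L → Fin L → ℕ, pairWeight q a ≠ 0 →
      a ∈ Fintype.piFinset fun i => Fintype.piFinset fun j => (Q i j).support := by
    intro a ha
    rw [pairWeight] at ha
    split_ifs at ha with h0
    · simp only [Fintype.mem_piFinset, Polynomial.mem_support_iff]
      intro i j
      by_cases h : i < j
      · rw [hQ2 i j h]
        exact Finset.prod_ne_zero_iff.1 ha (i, j) (by simpa using h)
      · rw [hQ1 i j h, h0 i j h]
        simp
    · exact absurd rfl ha
  rw [multiCoeff, hP, finsum_eq_sum_of_support_subset
    (s := Fintype.piFinset fun i => Fintype.piFinset fun j => (Q i j).support) _ (fun a ha =>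
      hsupp a (left_ne_zero_of_smul ha)), map_sum, LinearMap.sum_apply, Finset.sum_apply]
  refine Finset.sum_congr rfl fun a ha => ?_
  simp only [Fintype.mem_piFinset, Polynomial.mem_support_iff] at ha
  have h0 : ∀ i j, ¬ i < j → a i j = 0 := fun i j h => by
    have := ha i j
    rw [hQ1 i j h, Polynomial.coeff_one] at this
    by_contra h'
    exact this (if_neg h')
  have hw : pairWeight q a = ∏ i, ∏ j, (Q i j).coeff (a i j) := by
    rw [pairWeight, if_pos h0, Finset.prod_filter, ← Finset.univ_product_univ,
      Finset.prod_product]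
    refine Finset.prod_congr rfl fun i _ => Finset.prod_congr rfl fun j _ => ?_
    by_cases h : i < j
    · rw [hQ2 i j h, if_pos h]
    · rw [hQ1 i j h, if_neg h, h0 i j h, Polynomial.coeff_one_zero]
  have hs : ∀ i, shiftIdx a i = (∑ i, ∑ j, pairHom i j (a i j)) i := by
    intro i
    simp only [pairHom_apply, Finset.sum_apply, Pi.sub_apply, Finset.sum_sub_distrib,
      Pi.single_apply]
    rw [shiftIdx]
    congr 1
    · rw [Finset.sum_comm]
      refine Finset.sum_congr rfl fun j _ => ?_
      rw [Finset.sum_ite_eq Finset.univ i, if_pos (Finset.mem_univ i)]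
      split_ifs with h
      · rfl
      · rw [h0 i j h, Nat.cast_zero]
    · refine Finset.sum_congr rfl fun j _ => ?_
      rw [Finset.sum_ite_eq Finset.univ i, if_pos (Finset.mem_univ i)]
      split_ifs with h
      · rfl
      · rw [h0 j i h, Nat.cast_zero]
  rw [shiftAct_single, hw]
  simp only [hs, Pi.sub_apply]

end Multi

theorem shiftAct_apply_eq_zero_of_lt {ι W : Type} [AddCommGroup W] [Module ℂ W]
    {F : (ι → ℤ) → Module.End ℂ W} {w : W} {i : ι} {N : ℤ}
    (hF : ∀ m, m i < N → F m w = 0) (P : AddMonoidAlgebra ℂ (ι → ℤ)) :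
    ∃ N' : ℤ, ∀ m, m i < N' → shiftAct _ _ P F m w = 0 := by
  obtain ⟨B, hB⟩ := (P.coeff.support.image fun s => s i).bddBelow
  refine ⟨N + B, fun m hm => ?_⟩
  rw [shiftAct_apply, Finsupp.sum, LinearMap.sum_apply]
  refine Finset.sum_eq_zero fun s hs => ?_
  have : B ≤ s i := hB (Finset.mem_coe.2 (Finset.mem_image_of_mem _ hs))
  rw [LinearMap.smul_apply, hF _ (by rw [Pi.sub_apply]; omega), smul_zero]

section Bounded

variable {ι : Type} [DecidableEq ι] {W : Type} [AddCommGroup W] [Module ℂ W]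

/-- The product `A(z_{i₁})⋯A(z_{i_k})` over a list of variables. -/
def listProd (A : ℤ → Module.End ℂ W) (l : List ι) (m : ι → ℤ) : Module.End ℂ W :=
  (l.map fun i => A (m i)).prod

theorem listProd_add_pairHom (A : ℤ → Module.End ℂ W) {l : List ι} {i j : ι} (hi : i ∉ l)
    (hj : j ∉ l) (s : ℤ) (m : ι → ℤ) : listProd A l (m + pairHom i j s) = listProd A l m := by
  unfold listProd
  congr 1
  refine List.map_congr_left fun k hk => ?_
  have hki : k ≠ i := fun h => hi (h ▸ hk)
  have hkj : k ≠ j := fun h => hj (h ▸ hk)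
  simp [hki, hkj]

theorem shiftAct_pairHom {X : Type} [AddCommGroup X] [Module ℂ X] {i j : ι} (hij : i ≠ j)
    (P : AddMonoidAlgebra ℂ ℤ) (H : ℤ × ℤ → X) (m : ι → ℤ) :
    shiftAct _ _ (AddMonoidAlgebra.mapDomainAlgHom ℂ ℂ (pairHom i j) P) (fun m => H (m i, m j)) m
      = shiftAct _ _ (AddMonoidAlgebra.mapDomainAlgHom ℂ ℂ ratioHom P) H (m i, m j) := by
  rw [shiftAct_mapDomain, shiftAct_mapDomain]
  refine congrArg (fun f => shiftAct ℤ X P f 0) (funext fun s => congrArg H ?_)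
  simp [hij, hij.symm, sub_eq_add_neg]

theorem listProd_swap {A : ℤ → Module.End ℂ W} {q : Polynomial ℂ}
    (hA : shiftAct _ _ (evalMonomial ratioHom q) (fun p => A p.1 * A p.2)
      = shiftAct _ _ (evalMonomial ratioHom q) (fun p => A p.2 * A p.1))
    {l₁ l₂ : List ι} {i j : ι} (h : (l₁ ++ i :: j :: l₂).Nodup) :
    shiftAct _ _ (evalMonomial (pairHom i j) q) (listProd A (l₁ ++ i :: j :: l₂))
      = shiftAct _ _ (evalMonomial (pairHom i j) q) (listProd A (l₁ ++ j :: i :: l₂)) := by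
  simp only [List.nodup_append, List.nodup_cons, List.mem_cons, not_or] at h
  obtain ⟨-, ⟨⟨hij, hi2⟩, hj2, -⟩, hd⟩ := h
  have hi1 : i ∉ l₁ := fun hi => hd i hi i (Or.inl rfl) rfl
  have hj1 : j ∉ l₁ := fun hj => hd j hj j (Or.inr (Or.inl rfl)) rfl
  set T : (ι → ℤ) → Module.End ℂ W →ₗ[ℂ] Module.End ℂ W := fun m =>
    (LinearMap.mulLeft ℂ (listProd A l₁ m)).comp (LinearMap.mulRight ℂ (listProd A l₂ m))
  have hT : ∀ s m, T (m + pairHom i j s) = T m := fun s m => by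
    simp only [T, listProd_add_pairHom A hi1 hj1, listProd_add_pairHom A hi2 hj2]
  have h1 : listProd A (l₁ ++ i :: j :: l₂) = fun m => T m (A (m i) * A (m j)) := by
    funext m; simp [listProd, T, mul_assoc]
  have h2 : listProd A (l₁ ++ j :: i :: l₂) = fun m => T m (A (m j) * A (m i)) := by
    funext m; simp [listProd, T, mul_assoc]
  rw [h1, h2, evalMonomial_eq, shiftAct_mapDomain_comm _ T hT, shiftAct_mapDomain_comm _ T hT]
  funext m
  congr 1
  rw [shiftAct_pairHom hij _ (fun p => A p.1 * A p.2),
    shiftAct_pairHom hij _ (fun p => A p.2 * A p.1)]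
  exact congrFun hA _

theorem listProd_move {A : ℤ → Module.End ℂ W} {q : Polynomial ℂ}
    (hA : shiftAct _ _ (evalMonomial ratioHom q) (fun p => A p.1 * A p.2)
      = shiftAct _ _ (evalMonomial ratioHom q) (fun p => A p.2 * A p.1))
    (i : ι) (l₁ l₂ : List ι) (h : (l₁ ++ i :: l₂).Nodup) :
    shiftAct _ _ (l₂.map fun j => evalMonomial (pairHom i j) q).prod (listProd A (l₁ ++ i :: l₂))
      = shiftAct _ _ (l₂.map fun j => evalMonomial (pairHom i j) q).prod
          (listProd A (l₁ ++ l₂ ++ [i])) := by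
  induction l₂ generalizing l₁ with
  | nil => simp
  | cons j l₂ ih =>
    have h' : ((l₁ ++ [j]) ++ i :: l₂).Nodup := by
      refine (List.Perm.nodup_iff ?_).1 h
      rw [List.append_assoc]
      exact (List.Perm.swap j i l₂).append_left l₁
    have := ih (l₁ ++ [j]) h'
    rw [List.map_cons, List.prod_cons, mul_comm, shiftAct_mul, listProd_swap hA h, ← shiftAct_mul,
      mul_comm, shiftAct_mul, shiftAct_mul]
    simp only [List.append_assoc, List.cons_append, List.nil_append] at this ⊢
    rw [this]

theorem pairProd_lowerBdd {A : ℤ → Module.End ℂ W} {q : Polynomial ℂ}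
    (hA : shiftAct _ _ (evalMonomial ratioHom q) (fun p => A p.1 * A p.2)
      = shiftAct _ _ (evalMonomial ratioHom q) (fun p => A p.2 * A p.1))
    (hA0 : ∀ w, ∃ N : ℤ, ∀ n, n < N → A n w = 0) (L : ℕ) (w : W) :
    ∃ N : ℤ, ∀ m : Fin L → ℤ, (∃ i, m i < N) →
      shiftAct _ _ (pairProd q L) (listProd A (List.finRange L)) m w = 0 := by
  have key : ∀ i : Fin L, ∃ N : ℤ, ∀ m, m i < N →
      shiftAct _ _ (pairProd q L) (listProd A (List.finRange L)) m w = 0 := by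
    intro i
    obtain ⟨l₁, l₂, hl⟩ := List.append_of_mem (List.mem_finRange i)
    have hnd : (l₁ ++ i :: l₂).Nodup := hl ▸ List.nodup_finRange L
    have hlt : ∀ j ∈ l₂, i < j := by
      have := List.pairwise_lt_finRange L
      rw [hl, List.pairwise_append, List.pairwise_cons] at this
      exact this.2.1.1
    have hdvd : (l₂.map fun j => evalMonomial (pairHom i j) q).prod ∣ pairProd q L := by
      have hnd2 : l₂.Nodup := (List.nodup_cons.1 (List.nodup_append.1 hnd).2.1).2
      rw [← List.prod_toFinset _ hnd2, pairProd, ← Finset.prod_image (s := l₂.toFinset)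
        (g := fun j => (i, j)) (f := fun p : Fin L × Fin L => evalMonomial (pairHom p.1 p.2) q)
        (fun x _ y _ hxy => (Prod.mk.inj hxy).2)]
      refine Finset.prod_dvd_prod_of_subset _ _ _ fun p hp => ?_
      obtain ⟨j, hj, rfl⟩ := Finset.mem_image.1 hp
      simpa using hlt j (List.mem_toFinset.1 hj)
    obtain ⟨R, hR⟩ := hdvd
    have hmove : shiftAct _ _ (pairProd q L) (listProd A (List.finRange L))
        = shiftAct _ _ (pairProd q L) (listProd A (l₁ ++ l₂ ++ [i])) := by
      rw [hR, mul_comm, shiftAct_mul, shiftAct_mul, hl, listProd_move hA i l₁ l₂ hnd]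
    rw [hmove]
    obtain ⟨N, hN⟩ := hA0 w
    refine shiftAct_apply_eq_zero_of_lt (N := N) (fun m hm => ?_) _
    simp [listProd, hN _ hm]
  choose N hN using key
  obtain ⟨B, hB⟩ := (Finset.univ.image N).bddBelow
  exact ⟨B, fun m ⟨i, hi⟩ =>
    hN i m (hi.trans_le (hB (Finset.mem_coe.2 (Finset.mem_image_of_mem _ (Finset.mem_univ i)))))⟩

end Bounded

section Push

variable {M N K X : Type} [AddCommGroup M] [AddCommGroup N] [AddCommGroup K]
  [AddCommGroup X]

/-- The formal distribution obtained from `F` by specialising the variables along `σ`. -/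
def push [DecidableEq N] (σ : M →+ N) (F : M → X) (n : N) : X :=
  ∑ᶠ m, if σ m = n then F m else 0

/-- The specialisation of `F` along `σ` involves only finite sums. -/
def FiberFinite (σ : M →+ N) (F : M → X) : Prop :=
  ∀ n, {m | σ m = n ∧ F m ≠ 0}.Finite

theorem FiberFinite.finite {σ : M →+ N} {F : M → X} (h : FiberFinite σ F) (n : N) :
    {m | σ m = n ∧ F m ≠ 0}.Finite := h n

theorem push_eq_sum [DecidableEq N] (σ : M →+ N) (F : M → X) (n : N) (s : Finset M)
    (hs : ∀ m ∈ s, σ m = n) (h : ∀ m, σ m = n → F m ≠ 0 → m ∈ s) :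
    push σ F n = ∑ m ∈ s, F m := by
  rw [push, finsum_eq_sum_of_support_subset (s := s) _ fun m hm => ?_]
  · exact Finset.sum_congr rfl fun m hm => if_pos (hs m hm)
  · rw [Function.mem_support, ite_ne_right_iff] at hm
    exact h m hm.1 hm.2

theorem push_eq_sum_toFinset [DecidableEq N] {σ : M →+ N} {F : M → X} (h : FiberFinite σ F) (n : N) :
    push σ F n = ∑ m ∈ (h.finite n).toFinset, F m :=
  push_eq_sum σ F n _ (fun _ hm => ((h.finite n).mem_toFinset.1 hm).1) fun _ h1 h2 =>
    (h.finite n).mem_toFinset.2 ⟨h1, h2⟩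

theorem push_push [DecidableEq N] [DecidableEq K] (σ : M →+ N) (τ : N →+ K) {F : M → X} (h : FiberFinite (τ.comp σ) F) (k : K) :
    push τ (push σ F) k = push (τ.comp σ) F k := by
  set S := (h.finite k).toFinset
  have hS : ∀ m, m ∈ S ↔ τ (σ m) = k ∧ F m ≠ 0 := fun m => (h.finite k).mem_toFinset
  have hin : ∀ n, τ n = k → push σ F n = ∑ m ∈ S with σ m = n, F m := fun n hn =>
    push_eq_sum σ F n _ (fun m hm => (Finset.mem_filter.1 hm).2) fun m h1 h2 =>
      Finset.mem_filter.2 ⟨(hS m).2 ⟨by rw [h1, hn], h2⟩, h1⟩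
  have himg : ∀ n ∈ S.image σ, τ n = k := fun n hn => by
    obtain ⟨m, hm, rfl⟩ := Finset.mem_image.1 hn
    exact ((hS m).1 hm).1
  rw [push_eq_sum_toFinset h, push_eq_sum τ _ k (S.image σ) himg fun n h1 h2 => ?_,
    ← Finset.sum_fiberwise_of_maps_to (g := σ) (t := S.image σ)
      fun m hm => Finset.mem_image_of_mem σ hm]
  · exact Finset.sum_congr rfl fun n hn => hin n (himg n hn)
  · rw [hin n h1] at h2
    obtain ⟨m, hm, -⟩ := Finset.exists_ne_zero_of_sum_ne_zero h2
    rw [Finset.mem_filter] at hm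
    exact hm.2 ▸ Finset.mem_image_of_mem σ hm.1

variable [Module ℂ X]

theorem FiberFinite.shiftAct {σ : M →+ N} {F : M → X} (h : FiberFinite σ F)
    (P : AddMonoidAlgebra ℂ M) : FiberFinite σ (shiftAct M X P F) := by
  induction P using AddMonoidAlgebra.induction_linear with
  | zero => intro n; simp
  | add P Q hP hQ =>
    intro n
    refine ((hP n).union (hQ n)).subset fun m hm => ?_
    by_contra hm'
    simp only [Set.mem_union, Set.mem_ofPred_eq, hm.1, true_and, not_or, not_not] at hm'
    exact hm.2 (by rw [map_add, LinearMap.add_apply, Pi.add_apply, hm'.1, hm'.2, add_zero])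
  | single s c =>
    intro n
    refine ((h (n - σ s)).image (· + s)).subset fun m hm => ⟨m - s, ⟨?_, fun h0 => hm.2 ?_⟩, ?_⟩
    · rw [map_sub, hm.1]
    · rw [shiftAct_single, h0, smul_zero]
    · exact sub_add_cancel m s

theorem push_shiftAct [DecidableEq N] {σ : M →+ N} {F : M → X} (h : FiberFinite σ F)
    (P : AddMonoidAlgebra ℂ M) :
    push σ (shiftAct M X P F)
      = shiftAct N X (AddMonoidAlgebra.mapDomainAlgHom ℂ ℂ σ P) (push σ F) := by
  induction P using AddMonoidAlgebra.induction_linear with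
  | zero => funext n; simp [push]
  | add P Q hP hQ =>
    rw [map_add, map_add, map_add, LinearMap.add_apply, LinearMap.add_apply, ← hP, ← hQ]
    funext n
    rw [Pi.add_apply, push, push, push, ← finsum_add_distrib]
    · refine finsum_congr fun m => ?_
      split_ifs <;> simp
    · refine (h.shiftAct P n).subset fun m hm => ?_
      rwa [Function.mem_support, ite_ne_right_iff] at hm
    · refine (h.shiftAct Q n).subset fun m hm => ?_
      rwa [Function.mem_support, ite_ne_right_iff] at hm
  | single s c =>
    funext n
    have h1 : AddMonoidAlgebra.mapDomainAlgHom ℂ ℂ σ (AddMonoidAlgebra.single s c)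
        = AddMonoidAlgebra.single (σ s) c := AddMonoidAlgebra.mapDomain_single
    rw [h1, shiftAct_single, push, push, smul_finsum,
      ← finsum_comp_equiv (Equiv.subRight s) (f := fun m => c • if σ m = n - σ s then F m else 0)]
    refine finsum_congr fun m => ?_
    simp only [shiftAct_single, Equiv.subRight_apply, map_sub, sub_left_inj]
    split_ifs <;> simp

end Push

theorem mapDomain_evalMonomial {M N : Type} [AddCommGroup M] [AddCommGroup N] (σ : M →+ N)
    (τ : ℤ →+ M) (q : Polynomial ℂ) :
    AddMonoidAlgebra.mapDomainAlgHom ℂ ℂ σ (evalMonomial τ q) = evalMonomial (σ.comp τ) q := by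
  rw [evalMonomial_eq_sum, evalMonomial_eq_sum, map_sum]
  exact Finset.sum_congr rfl fun i _ => AddMonoidAlgebra.mapDomain_single

/-- Specialisation of all variables to a single one. -/
def sumHom (l : ℕ) : (Fin l → ℤ) →+ ℤ where
  toFun m := ∑ i, m i
  map_zero' := by simp
  map_add' m m' := by simp [Finset.sum_add_distrib]

/-- Specialisation of all variables but the first to a single one. -/
def headSumHom (l : ℕ) : (Fin (l + 1) → ℤ) →+ ℤ × ℤ where
  toFun m := (m 0, ∑ i : Fin l, m i.succ)
  map_zero' := by simp
  map_add' m m' := by simp [Finset.sum_add_distrib]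

/-- The inclusion of the exponents of all variables but the first. -/
def tailEmb (l : ℕ) : (Fin l → ℤ) →+ (Fin (l + 1) → ℤ) where
  toFun m := Fin.cons 0 m
  map_zero' := by ext i; cases i using Fin.cases <;> simp
  map_add' m m' := by ext i; cases i using Fin.cases <;> simp

@[simp]
theorem sumHom_apply {l : ℕ} (m : Fin l → ℤ) : sumHom l m = ∑ i, m i := rfl

@[simp]
theorem headSumHom_apply {l : ℕ} (m : Fin (l + 1) → ℤ) :
    headSumHom l m = (m 0, ∑ i : Fin l, m i.succ) := rfl

@[simp]
theorem tailEmb_zero {l : ℕ} (m : Fin l → ℤ) : tailEmb l m 0 = 0 := rfl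

@[simp]
theorem tailEmb_succ {l : ℕ} (m : Fin l → ℤ) (i : Fin l) : tailEmb l m i.succ = m i := rfl

theorem pairProd_succ (q : Polynomial ℂ) (l : ℕ) :
    pairProd q (l + 1) = (∏ j : Fin l, evalMonomial (pairHom 0 j.succ) q)
      * AddMonoidAlgebra.mapDomainAlgHom ℂ ℂ (tailEmb l) (pairProd q l) := by
  have hcomp : ∀ i j : Fin l, (tailEmb l).comp (pairHom i j) = pairHom i.succ j.succ := by
    intro i j
    refine AddMonoidHom.ext fun k => funext fun t => ?_
    cases t using Fin.cases with
    | zero => simp [Fin.succ_ne_zero]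
    | succ t => simp [Pi.single_apply]
  simp only [pairProd, Finset.prod_filter, ← Finset.univ_product_univ, Finset.prod_product,
    map_prod]
  rw [Fin.prod_univ_succ]
  congr 1
  · rw [Fin.prod_univ_succ]
    simp [Fin.succ_pos]
  · refine Finset.prod_congr rfl fun i _ => ?_
    rw [Fin.prod_univ_succ, if_neg (Fin.not_lt_zero _), one_mul]
    refine Finset.prod_congr rfl fun j _ => ?_
    simp only [Fin.succ_lt_succ_iff]
    split_ifs
    · rw [mapDomain_evalMonomial, hcomp]
    · rw [map_one]

theorem mapDomain_headSumHom (q : Polynomial ℂ) (l : ℕ) :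
    AddMonoidAlgebra.mapDomainAlgHom ℂ ℂ (headSumHom l)
      (∏ j : Fin l, evalMonomial (pairHom 0 j.succ) q) = evalMonomial ratioHom (q ^ l) := by
  have hcomp : ∀ j : Fin l, (headSumHom l).comp (pairHom 0 j.succ) = ratioHom := by
    intro j
    refine AddMonoidHom.ext fun k => Prod.ext ?_ ?_
    · simp [Pi.single_apply, (Fin.succ_ne_zero _).symm]
    · simp [Pi.single_apply, Fin.succ_ne_zero]
  rw [map_prod, map_pow]
  simp only [mapDomain_evalMonomial, hcomp, Finset.prod_const, Finset.card_univ, Fintype.card_fin]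

theorem fiberFinite_sumHom {X : Type} [AddCommGroup X] {l : ℕ} {F : (Fin l → ℤ) → X}
    {N : ℤ} (hF : ∀ m, (∃ i, m i < N) → F m = 0) : FiberFinite (sumHom l) F := by
  intro n
  refine (Set.finite_Icc (fun _ => N) (fun _ => n - l * N + N)).subset fun m hm => ?_
  have hN : ∀ i, N ≤ m i := fun i => not_lt.1 fun hi => hm.2 (hF m ⟨i, hi⟩)
  refine ⟨hN, fun i => ?_⟩
  have h1 : m i - N ≤ ∑ j, (m j - N) :=
    Finset.single_le_sum (fun j _ => sub_nonneg.2 (hN j)) (Finset.mem_univ i)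
  have h2 : ∑ j, m j = n := hm.1
  rw [Finset.sum_sub_distrib, h2, Finset.sum_const, Finset.card_univ, Fintype.card_fin,
    nsmul_eq_mul] at h1
  dsimp only
  linarith

theorem shiftAct_tailEmb_listProd {W : Type} [AddCommGroup W] [Module ℂ W]
    (A : ℤ → Module.End ℂ W) {l : ℕ} (P : AddMonoidAlgebra ℂ (Fin l → ℤ)) :
    shiftAct _ _ (AddMonoidAlgebra.mapDomainAlgHom ℂ ℂ (tailEmb l) P)
        (listProd A (List.finRange (l + 1)))
      = fun m => A (m 0) * shiftAct _ _ P (listProd A (List.finRange l)) (fun i => m i.succ) := by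
  have h1 : listProd A (List.finRange (l + 1)) = fun m : Fin (l + 1) → ℤ =>
      LinearMap.mulLeft ℂ (A (m 0)) (listProd A (List.finRange l) fun i => m i.succ) := by
    funext m
    simp [listProd, List.finRange_succ, Function.comp_def]
  rw [h1, shiftAct_mapDomain_comm (tailEmb l) (fun m => LinearMap.mulLeft ℂ (A (m 0)))
    (fun s m => by simp)]
  funext m
  rw [LinearMap.mulLeft_apply]
  congr 1
  rw [shiftAct_mapDomain]
  have h2 : (fun s => listProd A (List.finRange l) fun i => (m + tailEmb l s) i.succ)
      = fun s => listProd A (List.finRange l)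
        ((fun i => m i.succ) + (AddMonoidHom.id (Fin l → ℤ)) s) := by
    funext s; rfl
  rw [h2, ← shiftAct_mapDomain, AddMonoidAlgebra.mapDomainAlgHom_id]
  rfl

theorem push_head_mul {W : Type} [AddCommGroup W] [Module ℂ W] (A : ℤ → Module.End ℂ W) {l : ℕ}
    {g : (Fin l → ℤ) → W} (hg : FiberFinite (sumHom l) g) :
    FiberFinite (headSumHom l) (fun m => A (m 0) (g fun i => m i.succ)) ∧
      ∀ p, push (headSumHom l) (fun m => A (m 0) (g fun i => m i.succ)) p
        = A p.1 (push (sumHom l) g p.2) := by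
  have hmem : ∀ (p : ℤ × ℤ) (m : Fin (l + 1) → ℤ), headSumHom l m = p →
      A (m 0) (g fun i => m i.succ) ≠ 0 →
        m ∈ ((hg.finite p.2).toFinset).image (fun t => (Fin.cons p.1 t : Fin (l + 1) → ℤ)) := by
    rintro p m rfl hm
    refine Finset.mem_image.2 ⟨fun i => m i.succ, (hg.finite _).mem_toFinset.2 ⟨rfl, fun h0 => ?_⟩, ?_⟩
    · exact hm (by rw [h0, map_zero])
    · exact Fin.cons_self_tail m
  refine ⟨fun p => (Finset.finite_toSet _).subset fun m hm => hmem p m hm.1 hm.2, fun p => ?_⟩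
  rw [push_eq_sum _ _ _ _ (fun m hm => ?_) (hmem p), Finset.sum_image
    (g := fun t => (Fin.cons p.1 t : Fin (l + 1) → ℤ))
    (fun x _ y _ hxy => Fin.cons_right_injective (α := fun _ => ℤ) p.1 hxy), push_eq_sum_toFinset hg, map_sum]
  · exact Finset.sum_congr rfl fun t _ => by simp
  · obtain ⟨t, ht, rfl⟩ := Finset.mem_image.1 hm
    have ht2 : ∑ i, t i = p.2 := ((hg.finite p.2).mem_toFinset.1 ht).1
    exact Prod.ext rfl (by simpa using ht2)

namespace PhiMod

variable {V W : Type} [AddCommGroup V] [Module ℂ V] [AddCommGroup W] [Module ℂ W]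
  {G : Type} [Group G] {VA : VertexAlg V} {ρ : G →* (V ≃ₗ[ℂ] V)} {χ : G →* ℂˣ}
  (M : PhiMod VA ρ χ W)

/-- Evaluation of a regular twisted product at `z₁ = z₂`. -/
theorem push_add_twisted {a b : V} (hab : ∀ n : ℤ, 0 ≤ n → VA.Y a n b = 0) {h : Polynomial ℂ}
    {w : W} (hB : LowerBdd fun p => M.twisted h a b p w) (n : ℤ) :
    push (AddMonoidHom.fst ℤ ℤ + AddMonoidHom.snd ℤ ℤ) (fun p => M.twisted h a b p w) n
      = h.eval 1 • M.E (VA.Y a (-1) b) n w := by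
  rw [← sub_eq_zero, ← Module.forall_dual_apply_eq_zero_iff ℂ]
  intro φ
  obtain ⟨β, hβ⟩ := (hB.matCoeff φ).exists_isDiagonal n
  have h0 := congrArg (PowerSeries.coeff 0) (M.expSubst_twisted hab hβ)
  rw [PowerSeries.coeff_mul, Finset.Nat.antidiagonal_zero, Finset.sum_singleton,
    constantCoeff_expSubst_toLaurent, hβ.coeff_expSubst, iterateSeries,
    PowerSeries.coeff_mk] at h0
  obtain ⟨N, hN⟩ := hB
  have hout : ∀ m, m ∉ Finset.Icc N (n - N) → M.twisted h a b (m, n - m) w = 0 := fun m hm => by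
    rw [Finset.mem_Icc, not_and_or, not_le, not_le] at hm
    exact hN _ _ (by omega)
  rw [push_eq_sum _ _ _ ((Finset.Icc N (n - N)).image fun m => (m, n - m)) (fun p hp => ?_)
    (fun p hp1 hp2 => ?_), Finset.sum_image (fun x _ y _ hxy => (Prod.mk.inj hxy).1), map_sub,
    map_sum, map_smul, sub_eq_zero]
  · rw [finsum_eq_sum_of_support_subset (s := Finset.Icc N (n - N)) _ (fun m hm => by
        by_contra hm'
        exact hm (by simp only [matCoeff_apply, hout m hm', map_zero, mul_zero]))] at h0
    simpa [subC] using h0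
  · obtain ⟨m, -, rfl⟩ := Finset.mem_image.1 hp
    simp
  · obtain ⟨m, k⟩ := p
    obtain rfl : k = n - m := by
      have : m + k = n := hp1
      omega
    refine Finset.mem_image.2 ⟨m, ?_, rfl⟩
    by_contra hm
    exact hp2 (hout m hm)

/-- The evaluation of `∏_{i<j} q(z_i/z_j) Y_W(u,z₁)⋯Y_W(u,z_l)` at `z₁ = ⋯ = z_l` is a nonzero
multiple of `Y_W((u₋₁)ˡ𝟏, z)`. -/
theorem push_sumHom_pairProd {u : V} (hu : ∀ n : ℤ, 0 ≤ n → VA.Y u n u = 0) {q : Polynomial ℂ}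
    (hq1 : q.eval 1 ≠ 0)
    (hq : shiftAct _ _ (evalMonomial ratioHom q) (fun p => M.E u p.1 * M.E u p.2)
      = shiftAct _ _ (evalMonomial ratioHom q) (fun p => M.E u p.2 * M.E u p.1)) (l : ℕ) :
    ∃ c : ℂ, c ≠ 0 ∧ ∀ n w, push (sumHom l)
        (fun m => shiftAct _ _ (pairProd q l) (listProd (M.E u) (List.finRange l)) m w) n
      = c • M.E ((VA.Y u (-1) ^ l) VA.one) n w := by
  induction l with
  | zero =>
    refine ⟨1, one_ne_zero, fun n w => ?_⟩
    have h1 : ∀ m : Fin 0 → ℤ,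
        shiftAct _ _ (pairProd q 0) (listProd (M.E u) (List.finRange 0)) m w = w := by
      intro m
      have : pairProd q 0 = 1 := Finset.prod_of_isEmpty _
      simp [this, listProd]
    rw [pow_zero, Module.End.one_apply, M.vacuum, push, finsum_eq_single _ 0
      fun m hm => absurd (Subsingleton.elim m 0) hm, h1, map_zero, one_smul]
    by_cases hn : n = 0
    · simp [hn]
    · simp [hn, Ne.symm hn]
  | succ l ih =>
    obtain ⟨c, hc, ih⟩ := ih
    refine ⟨c * q.eval 1 ^ l, mul_ne_zero hc (pow_ne_zero _ hq1), fun n w => ?_⟩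
    set v := (VA.Y u (-1) ^ l) VA.one
    have huv : ∀ n : ℤ, 0 ≤ n → VA.Y u n v = 0 := fun n hn => VA.mode_pow_apply_eq_zero hu l hn
    set g : (Fin l → ℤ) → W := fun m =>
      shiftAct _ _ (pairProd q l) (listProd (M.E u) (List.finRange l)) m w
    set g' : (Fin (l + 1) → ℤ) → W := fun m =>
      shiftAct _ _ (pairProd q (l + 1)) (listProd (M.E u) (List.finRange (l + 1))) m w
    obtain ⟨N, hN⟩ := pairProd_lowerBdd hq (M.lower_trunc u) l w
    obtain ⟨N', hN'⟩ := pairProd_lowerBdd hq (M.lower_trunc u) (l + 1) w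
    have hg : FiberFinite (sumHom l) g := fiberFinite_sumHom hN
    have hg' : FiberFinite (sumHom (l + 1)) g' := fiberFinite_sumHom hN'
    obtain ⟨hK, hKp⟩ := push_head_mul (M.E u) hg
    have hgK : g' = shiftAct _ _ (∏ j : Fin l, evalMonomial (pairHom 0 j.succ) q)
        (fun m => M.E u (m 0) (g fun i => m i.succ)) := by
      funext m
      simp only [g', g]
      rw [pairProd_succ, shiftAct_mul, shiftAct_tailEmb_listProd]
      exact (shiftAct_linearMap (LinearMap.applyₗ w) _ _ m).symm
    have hpush : push (headSumHom l) g' = fun p => c • M.twisted (q ^ l) u v p w := by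
      rw [hgK, push_shiftAct hK, mapDomain_headSumHom]
      have : push (headSumHom l) (fun m => M.E u (m 0) (g fun i => m i.succ))
          = fun p => (c • LinearMap.applyₗ w) (fieldProd (M.E u) (M.E v) p) := by
        funext p
        rw [hKp, ih]
        simp [fieldProd]
      rw [this]
      funext p
      exact shiftAct_linearMap (c • LinearMap.applyₗ w) _ _ p
    have hB : LowerBdd fun p => M.twisted (q ^ l) u v p w := by
      refine ⟨min N' (l * N'), fun a b hab => ?_⟩
      have hz : push (headSumHom l) g' (a, b) = 0 := by
        refine (push_eq_sum _ _ _ ∅ (by simp) fun m h1 h2 => absurd (hN' m ?_) h2).trans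
          Finset.sum_empty
        by_contra! hm
        have hb : l * N' ≤ b := by
          have h3 : ∑ i : Fin l, m i.succ = b := congrArg Prod.snd h1
          rw [← h3]
          simpa using Finset.sum_le_sum fun (i : Fin l) (_ : i ∈ Finset.univ) => hm i.succ
        have ha : N' ≤ a := by
          have h3 : m 0 = a := congrArg Prod.fst h1
          exact h3 ▸ hm 0
        omega
      rw [hpush] at hz
      exact (smul_eq_zero.1 hz).resolve_left hc
    have hcomp : sumHom (l + 1)
        = (AddMonoidHom.fst ℤ ℤ + AddMonoidHom.snd ℤ ℤ).comp (headSumHom l) :=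
      AddMonoidHom.ext fun m => Fin.sum_univ_succ m
    rw [hcomp, ← push_push _ _ (hcomp ▸ hg'), hpush]
    have hsmul := M.push_add_twisted huv hB n
    rw [Polynomial.eval_pow] at hsmul
    rw [pow_succ', Module.End.mul_apply, mul_smul, ← hsmul, push, push, smul_finsum]
    exact finsum_congr fun p => by split_ifs <;> simp

end PhiMod

/-- Let `u ∈ V` with `uₙu = 0` for `n ≥ 0`, `ℓ` a positive integer, and
`(W,Y_W^φ)` a `(G,χ)`-equivariant `φ`-coordinated quasi `V`-module.  Then there is `q` with
all roots in `χ(G)∖{1}` such that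
`(∏_{1≤i<j≤ℓ+1} q(z_i/z_j)) Y^φ(u,z₁)⋯Y^φ(u,z_{ℓ+1}) ∈ Hom(W, W((z₁,…,z_{ℓ+1})))`;
moreover if `(u₋₁)^{ℓ+1}𝟏 = 0` then the evaluation of this product at
`z₁ = ⋯ = z_{ℓ+1}` vanishes (coefficientwise: for every total degree `n`), and conversely,
if `W` is faithful and the evaluation vanishes then `(u₋₁)^{ℓ+1}𝟏 = 0`. -/
theorem statement_2 {V W : Type} [AddCommGroup V] [Module ℂ V]
    [AddCommGroup W] [Module ℂ W] {G : Type} [Group G]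
    (VA : VertexAlg V) (ρ : G →* (V ≃ₗ[ℂ] V)) (hρ : ∀ g, VA.IsAuto (ρ g))
    (χ : G →* ℂˣ) (M : PhiMod VA ρ χ W)
    (u : V) (hu : ∀ n : ℤ, 0 ≤ n → VA.Y u n u = 0) (ℓ : ℕ) (hℓ : 0 < ℓ) :
    ∃ q : Polynomial ℂ, q ≠ 0 ∧
      (∀ c : ℂ, q.IsRoot c → (∃ g : G, ((χ g : ℂ)) = c) ∧ c ≠ 1) ∧
      (∀ w : W, ∃ N : ℤ, ∀ m : Fin (ℓ + 1) → ℤ, (∃ i, m i < N) →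
        multiCoeff q (fun _ => M.E u) m w = 0) ∧
      (((VA.Y u (-1)) ^ (ℓ + 1)) VA.one = 0 →
        ∀ (n : ℤ) (w : W),
          (∑ᶠ m : Fin (ℓ + 1) → ℤ,
            if (∑ i, m i) = n then multiCoeff q (fun _ => M.E u) m w else 0) = 0) ∧
      ((∀ v : V, (∀ n : ℤ, M.E v n = 0) → v = 0) →
        (∀ (n : ℤ) (w : W),
          (∑ᶠ m : Fin (ℓ + 1) → ℤ,
            if (∑ i, m i) = n then multiCoeff q (fun _ => M.E u) m w else 0) = 0) →
        ((VA.Y u (-1)) ^ (ℓ + 1)) VA.one = 0) := by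
  obtain ⟨q, hq0, hqr, hq⟩ := M.exists_local hu
  have hq1 : q.eval 1 ≠ 0 := fun h => (hqr 1 h).2 rfl
  have hcoeff : ∀ m : Fin (ℓ + 1) → ℤ, multiCoeff q (fun _ => M.E u) m
      = shiftAct _ _ (pairProd q (ℓ + 1)) (listProd (M.E u) (List.finRange (ℓ + 1))) m := by
    intro m
    rw [multiCoeff_eq]
    simp only [List.ofFn_eq_map]
    rfl
  obtain ⟨c, hc, hev⟩ := M.push_sumHom_pairProd hu hq1 hq (ℓ + 1)
  have hsum : ∀ (n : ℤ) (w : W), (∑ᶠ m : Fin (ℓ + 1) → ℤ,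
      if (∑ i, m i) = n then multiCoeff q (fun _ => M.E u) m w else 0)
        = c • M.E ((VA.Y u (-1) ^ (ℓ + 1)) VA.one) n w := fun n w => by
    rw [← hev]
    simp only [hcoeff]
    rfl
  refine ⟨q, hq0, hqr, fun w => ?_, fun h0 n w => ?_, fun hfaith h0 => hfaith _ fun n => ?_⟩
  · simp only [hcoeff]
    exact pairProd_lowerBdd hq (M.lower_trunc u) (ℓ + 1) w
  · rw [hsum, h0, M.E_zero, LinearMap.zero_apply, smul_zero]
  · refine LinearMap.ext fun w => ?_
    have h := h0 n w
    rw [hsum] at h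
    exact (smul_eq_zero.1 h).resolve_left hc

end
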